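/- Let G be a finite simple graph containing six distinct vertices x1, x2, x3, x4, v1, v3 such that: x1 x2 x3 x4 is a 4-cycle (x1~x2, x2~x3, x3~x4, x4~x1); x2 has degree exactly 2; x1 and x3 have degree exactly 3, with third neighbors v1 and v3 respectively, where v1 and v3 have degree exactly 2 with second neighbors z1 and z3 lying outside S = {x1, x2, x3, x4, v1, v3}; and x4 has degree at most 3. If the graph G − S has an FII-partition, then G has an FII-partition. -/

import Mathlib

open scoped Classical

/-- `S` is a *2-independent set* of `G`: any two distinct vertices of `S` are at
distance at least 3 in `G`, i.e. they are non-adjacent and have no common neighbor. -/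
def TwoIndepSet {W : Type*} (G : SimpleGraph W) (S : Set W) : Prop :=
  ∀ u ∈ S, ∀ v ∈ S, u ≠ v → ¬G.Adj u v ∧ ∀ w, ¬(G.Adj u w ∧ G.Adj w v)

/-- `F ⊔ A ⊔ B` is an *FII-partition* of `G`: the three sets partition the vertex set,
the subgraph induced on `F` is a forest (acyclic), and `A`, `B` are 2-independent sets. -/
def IsFIIPartition {W : Type*} (G : SimpleGraph W) (F A B : Set W) : Prop :=
  (∀ v, v ∈ F ∨ v ∈ A ∨ v ∈ B) ∧
    Disjoint F A ∧ Disjoint F B ∧ Disjoint A B ∧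
    (G.induce F).IsAcyclic ∧ TwoIndepSet G A ∧ TwoIndepSet G B

/-- `G` admits some FII-partition. -/
def HasFIIPartition {W : Type*} (G : SimpleGraph W) : Prop :=
  ∃ F A B, IsFIIPartition G F A B

namespace SimpleGraph

variable {V : Type*} {G : SimpleGraph V}

theorem isAcyclic_induce_iff {s : Set V} :
    (G.induce s).IsAcyclic ↔
      ∀ (u : V) (c : G.Walk u u), c.IsCycle → ¬∀ w ∈ c.support, w ∈ s := by
  constructor
  · intro h u c hc hs
    refine h (c.induce s hs) (Walk.IsCycle.of_map (f := (Embedding.induce s).toHom) ?_)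
    rwa [Walk.map_induce]
  · intro h u c hc
    have hinj : Function.Injective (Embedding.induce (G := G) s).toHom := Subtype.val_injective
    refine h _ _ (hc.map hinj) fun w hw => ?_
    rw [Walk.support_map, List.mem_map] at hw
    obtain ⟨a, -, rfl⟩ := hw
    exact a.2

/-- Adding a vertex with at most one neighbor in `s` keeps the subgraph induced on `s` acyclic. -/
theorem IsAcyclic.induce_insert {s : Set V} {v : V} (h : (G.induce s).IsAcyclic)
    (hv : ∀ a ∈ s, ∀ b ∈ s, G.Adj v a → G.Adj v b → a = b) :
    (G.induce (insert v s)).IsAcyclic := by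
  rw [isAcyclic_induce_iff] at h ⊢
  intro u c hc hs
  by_cases hvc : v ∈ c.support
  · have hc' := hc.rotate hvc
    have hs' : ∀ w ∈ (c.rotate v hvc).support, w ∈ insert v s := fun w hw =>
      hs w (by simpa using hw)
    have h1 := (c.rotate v hvc).adj_snd hc'.not_nil
    have h2 := ((c.rotate v hvc).adj_penultimate hc'.not_nil).symm
    refine hc'.snd_ne_penultimate (hv _ ?_ _ ?_ h1 h2)
    · exact (hs' _ (Walk.getVert_mem_support _ _)).resolve_left h1.ne'
    · exact (hs' _ (Walk.getVert_mem_support _ _)).resolve_left h2.ne'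
  · exact h u c hc fun w hw => (hs w hw).resolve_left fun e => hvc (e ▸ hw)

end SimpleGraph

theorem TwoIndepSet.insert {V : Type*} {G : SimpleGraph V} {A : Set V} {v : V}
    (h : TwoIndepSet G A) (hv : ∀ a ∈ A, ¬G.Adj v a)
    (hv' : ∀ a ∈ A, ∀ w, G.Adj v w → ¬G.Adj w a) : TwoIndepSet G (insert v A) := by
  rintro a (rfl | ha) b (rfl | hb) hab
  · exact absurd rfl hab
  · exact ⟨hv b hb, fun w hw => hv' b hb w hw.1 hw.2⟩
  · exact ⟨fun e => hv a ha e.symm, fun w hw => hv' a ha w hw.2.symm hw.1.symm⟩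
  · exact h a ha b hb hab

/-- A 2-independent set of `G.induce U` is 2-independent in `G` when no vertex outside `U` has two
neighbors in `U`. -/
theorem TwoIndepSet.image_val {V : Type*} {G : SimpleGraph V} {U : Set V} {A : Set U}
    (h : TwoIndepSet (G.induce U) A)
    (hU : ∀ w ∉ U, ∀ a ∈ U, ∀ b ∈ U, G.Adj w a → G.Adj w b → a = b) :
    TwoIndepSet G (Subtype.val '' A) := by
  rintro _ ⟨a, ha, rfl⟩ _ ⟨b, hb, rfl⟩ hab
  have hab' := h a ha b hb fun e => hab (congrArg _ e)
  refine ⟨hab'.1, fun w hw => ?_⟩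
  by_cases hwU : w ∈ U
  · exact hab'.2 ⟨w, hwU⟩ hw
  · exact hab (hU w hwU a a.2 b b.2 hw.1.symm hw.2)

/-- `F ⊔ A ⊔ B = U` where `F` induces a forest of `G`, and `A` and `B` are 2-independent in `G`. -/
structure IsFIIPartitionOn {V : Type*} (G : SimpleGraph V) (U F A B : Set V) : Prop where
  mem_iff : ∀ v, v ∈ U ↔ v ∈ F ∨ v ∈ A ∨ v ∈ B
  disjoint_FA : Disjoint F A
  disjoint_FB : Disjoint F B
  disjoint_AB : Disjoint A B
  isAcyclic : (G.induce F).IsAcyclic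
  twoIndepSet_A : TwoIndepSet G A
  twoIndepSet_B : TwoIndepSet G B

namespace IsFIIPartitionOn

variable {V : Type*} {G : SimpleGraph V} {U F A B : Set V} {v : V}

theorem symm (h : IsFIIPartitionOn G U F A B) : IsFIIPartitionOn G U F B A :=
  ⟨fun v => by rw [h.mem_iff, or_comm (a := v ∈ A)], h.disjoint_FB, h.disjoint_FA,
    h.disjoint_AB.symm, h.isAcyclic, h.twoIndepSet_B, h.twoIndepSet_A⟩

theorem insert_F (h : IsFIIPartitionOn G U F A B) (hvU : v ∉ U)
    (hv : ∀ a ∈ F, ∀ b ∈ F, G.Adj v a → G.Adj v b → a = b) :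
    IsFIIPartitionOn G (insert v U) (insert v F) A B := by
  have hvU' := (h.mem_iff v).not.1 hvU
  push Not at hvU'
  exact ⟨fun w => by rw [Set.mem_insert_iff, Set.mem_insert_iff, h.mem_iff, or_assoc],
    Set.disjoint_insert_left.2 ⟨hvU'.2.1, h.disjoint_FA⟩,
    Set.disjoint_insert_left.2 ⟨hvU'.2.2, h.disjoint_FB⟩,
    h.disjoint_AB, h.isAcyclic.induce_insert hv, h.twoIndepSet_A, h.twoIndepSet_B⟩

theorem insert_A (h : IsFIIPartitionOn G U F A B) (hvU : v ∉ U)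
    (hv : ∀ a ∈ A, ¬G.Adj v a) (hv' : ∀ a ∈ A, ∀ w, G.Adj v w → ¬G.Adj w a) :
    IsFIIPartitionOn G (insert v U) F (insert v A) B := by
  have hvU' := (h.mem_iff v).not.1 hvU
  push Not at hvU'
  exact ⟨fun w => by rw [Set.mem_insert_iff, Set.mem_insert_iff, h.mem_iff]; tauto,
    Set.disjoint_insert_right.2 ⟨hvU'.1, h.disjoint_FA⟩, h.disjoint_FB,
    Set.disjoint_insert_left.2 ⟨hvU'.2.2, h.disjoint_AB⟩,
    h.isAcyclic, h.twoIndepSet_A.insert hv hv', h.twoIndepSet_B⟩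

theorem hasFIIPartition (h : IsFIIPartitionOn G U F A B) (hU : ∀ v, v ∈ U) :
    HasFIIPartition G :=
  ⟨F, A, B, fun v => (h.mem_iff v).1 (hU v), h.disjoint_FA, h.disjoint_FB, h.disjoint_AB,
    h.isAcyclic, h.twoIndepSet_A, h.twoIndepSet_B⟩

end IsFIIPartitionOn

theorem IsFIIPartition.isFIIPartitionOn {V : Type*} {G : SimpleGraph V} {U : Set V}
    {F A B : Set U} (h : IsFIIPartition (G.induce U) F A B)
    (hU : ∀ w ∉ U, ∀ a ∈ U, ∀ b ∈ U, G.Adj w a → G.Adj w b → a = b) :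
    IsFIIPartitionOn G U (Subtype.val '' F) (Subtype.val '' A) (Subtype.val '' B) := by
  obtain ⟨hcov, hFA, hFB, hAB, hF, hA, hB⟩ := h
  have hinj := Subtype.val_injective (p := (· ∈ U))
  refine ⟨fun v => ?_, (Set.disjoint_image_iff hinj).2 hFA, (Set.disjoint_image_iff hinj).2 hFB,
    (Set.disjoint_image_iff hinj).2 hAB, ?_, hA.image_val hU, hB.image_val hU⟩
  · constructor
    · intro hv
      exact (hcov ⟨v, hv⟩).imp (fun h => ⟨_, h, rfl⟩)
        (Or.imp (fun h => ⟨_, h, rfl⟩) (fun h => ⟨_, h, rfl⟩))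
    · rintro (⟨a, -, rfl⟩ | ⟨a, -, rfl⟩ | ⟨a, -, rfl⟩) <;> exact a.2
  · rw [SimpleGraph.isAcyclic_induce_iff] at hF ⊢
    intro u c hc hs
    have hs' : ∀ w ∈ c.support, w ∈ U := fun w hw => by
      obtain ⟨a, -, rfl⟩ := hs w hw
      exact a.2
    refine hF _ (c.induce U hs') (SimpleGraph.Walk.IsCycle.of_map
      (f := (SimpleGraph.Embedding.induce U).toHom) ?_) fun w hw => ?_
    · rwa [SimpleGraph.Walk.map_induce]
    · rw [SimpleGraph.Walk.support_induce, List.mem_attachWith] at hw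
      obtain ⟨a, ha, hav⟩ := hs _ hw
      rwa [← Subtype.ext hav]

/-- The 4-cycle `x1 x2 x3 x4` with pendant paths `x1 v1 z1`, `x3 v3 z3` and `x4 z4`, where `U` is the
complement of `{x1, x2, x3, x4, v1, v3}`: the neighborhood of each vertex outside `U` is bounded
from above. -/
structure IsFourCycleConfig {V : Type*} (G : SimpleGraph V) (U : Set V)
    (x1 x2 x3 x4 v1 v3 z1 z3 z4 : V) : Prop where
  nodup : [x1, x2, x3, x4, v1, v3].Nodup
  mem_iff : ∀ w, w ∈ U ↔ w ≠ x1 ∧ w ≠ x2 ∧ w ≠ x3 ∧ w ≠ x4 ∧ w ≠ v1 ∧ w ≠ v3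
  z1_mem : z1 ∈ U
  z3_mem : z3 ∈ U
  z4_mem : z4 ∈ U
  adj_x1 : ∀ w, G.Adj x1 w → w = x2 ∨ w = x4 ∨ w = v1
  adj_x2 : ∀ w, G.Adj x2 w → w = x1 ∨ w = x3
  adj_x3 : ∀ w, G.Adj x3 w → w = x2 ∨ w = x4 ∨ w = v3
  adj_x4 : ∀ w, G.Adj x4 w → w = x1 ∨ w = x3 ∨ w = z4
  adj_v1 : ∀ w, G.Adj v1 w → w = x1 ∨ w = z1
  adj_v3 : ∀ w, G.Adj v3 w → w = x3 ∨ w = z3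

namespace IsFourCycleConfig

variable {V : Type*} {G : SimpleGraph V} {U F A B : Set V} {x1 x2 x3 x4 v1 v3 z1 z3 z4 : V}

theorem symm (c : IsFourCycleConfig G U x1 x2 x3 x4 v1 v3 z1 z3 z4) :
    IsFourCycleConfig G U x3 x2 x1 x4 v3 v1 z3 z1 z4 where
  nodup := by
    have := c.nodup
    simp only [List.nodup_cons, List.mem_cons, List.not_mem_nil] at this ⊢
    grind
  mem_iff w := by rw [c.mem_iff]; tauto
  z1_mem := c.z3_mem
  z3_mem := c.z1_mem
  z4_mem := c.z4_mem
  adj_x1 := c.adj_x3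
  adj_x2 w hw := (c.adj_x2 w hw).symm
  adj_x3 := c.adj_x1
  adj_x4 w hw := by have := c.adj_x4 w hw; tauto
  adj_v1 := c.adj_v3
  adj_v3 := c.adj_v1

theorem eq_of_adj_of_mem (c : IsFourCycleConfig G U x1 x2 x3 x4 v1 v3 z1 z3 z4) :
    ∀ w ∉ U, ∀ a ∈ U, ∀ b ∈ U, G.Adj w a → G.Adj w b → a = b := by
  obtain ⟨hn, hU, h1, h3, h4, a1, a2, a3, a4, b1, b3⟩ := c
  grind

theorem hasFIIPartition_of_z1_z3_notMem
    (c : IsFourCycleConfig G U x1 x2 x3 x4 v1 v3 z1 z3 z4) (h : IsFIIPartitionOn G U F A B)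
    (hz1 : z1 ∉ F) (hz3 : z3 ∉ F) : HasFIIPartition G := by
  obtain ⟨hn, hU, h1, h3, h4, a1, a2, a3, a4, b1, b3⟩ := c
  simp only [List.nodup_cons, List.mem_cons, List.not_mem_nil] at hn
  have hm := h.mem_iff
  replace h := h.insert_A (v := x2) (by grind) (by grind) (by grind)
  replace h := h.insert_F (v := x4) (by grind) (by grind)
  replace h := h.insert_F (v := x1) (by grind) (by grind)
  replace h := h.insert_F (v := x3) (by grind) (by grind)
  replace h := h.insert_F (v := v1) (by grind) (by grind)
  replace h := h.insert_F (v := v3) (by grind) (by grind)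
  exact h.hasFIIPartition (by grind)

theorem hasFIIPartition_of_z3_z4_notMem
    (c : IsFourCycleConfig G U x1 x2 x3 x4 v1 v3 z1 z3 z4) (h : IsFIIPartitionOn G U F A B)
    (hz3 : z3 ∉ F) (hz4 : z4 ∉ F) : HasFIIPartition G := by
  obtain ⟨hn, hU, h1, h3, h4, a1, a2, a3, a4, b1, b3⟩ := c
  simp only [List.nodup_cons, List.mem_cons, List.not_mem_nil] at hn
  have hm := h.mem_iff
  replace h := h.insert_A (v := x2) (by grind) (by grind) (by grind)
  replace h := h.insert_F (v := v1) (by grind) (by grind)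
  replace h := h.insert_F (v := x1) (by grind) (by grind)
  replace h := h.insert_F (v := x4) (by grind) (by grind)
  replace h := h.insert_F (v := x3) (by grind) (by grind)
  replace h := h.insert_F (v := v3) (by grind) (by grind)
  exact h.hasFIIPartition (by grind)

theorem hasFIIPartition_of_z1_z4_notMem_A_of_z3_z4_notMem_B
    (c : IsFourCycleConfig G U x1 x2 x3 x4 v1 v3 z1 z3 z4) (h : IsFIIPartitionOn G U F A B)
    (hz1A : z1 ∉ A) (hz4A : z4 ∉ A) (hz3B : z3 ∉ B) (hz4B : z4 ∉ B) : HasFIIPartition G := by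
  obtain ⟨hn, hU, h1, h3, h4, a1, a2, a3, a4, b1, b3⟩ := c
  simp only [List.nodup_cons, List.mem_cons, List.not_mem_nil] at hn
  have hm := h.mem_iff
  replace h := h.insert_A (v := x1) (by grind) (by grind) (by grind)
  replace h := (h.symm.insert_A (v := x3) (by grind) (by grind) (by grind)).symm
  replace h := h.insert_F (v := v1) (by grind) (by grind)
  replace h := h.insert_F (v := v3) (by grind) (by grind)
  replace h := h.insert_F (v := x4) (by grind) (by grind)
  replace h := h.insert_F (v := x2) (by grind) (by grind)
  exact h.hasFIIPartition (by grind)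

theorem hasFIIPartition_of_z1_z4_notMem_A_of_z4_notMem_F
    (c : IsFourCycleConfig G U x1 x2 x3 x4 v1 v3 z1 z3 z4) (h : IsFIIPartitionOn G U F A B)
    (hz1A : z1 ∉ A) (hz4A : z4 ∉ A) (hz4F : z4 ∉ F) : HasFIIPartition G := by
  obtain ⟨hn, hU, h1, h3, h4, a1, a2, a3, a4, b1, b3⟩ := c
  simp only [List.nodup_cons, List.mem_cons, List.not_mem_nil] at hn
  have hm := h.mem_iff
  replace h := h.insert_A (v := x1) (by grind) (by grind) (by grind)
  replace h := h.insert_F (v := v1) (by grind) (by grind)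
  replace h := h.insert_F (v := v3) (by grind) (by grind)
  replace h := h.insert_F (v := x3) (by grind) (by grind)
  replace h := h.insert_F (v := x4) (by grind) (by grind)
  replace h := h.insert_F (v := x2) (by grind) (by grind)
  exact h.hasFIIPartition (by grind)

theorem hasFIIPartition (c : IsFourCycleConfig G U x1 x2 x3 x4 v1 v3 z1 z3 z4)
    (h : IsFIIPartitionOn G U F A B) : HasFIIPartition G := by
  have hFA := Set.disjoint_left.1 h.disjoint_FA
  have hFB := Set.disjoint_left.1 h.disjoint_FB
  have hAB := Set.disjoint_left.1 h.disjoint_AB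
  by_cases h1 : z1 ∈ F
  · by_cases h3 : z3 ∈ F
    · by_cases h4 : z4 ∈ F
      · exact c.hasFIIPartition_of_z1_z4_notMem_A_of_z3_z4_notMem_B h (hFA h1) (hFA h4) (hFB h3)
          (hFB h4)
      · by_cases h4A : z4 ∈ A
        · exact c.hasFIIPartition_of_z1_z4_notMem_A_of_z4_notMem_F h.symm (hFB h1) (hAB h4A) h4
        · exact c.hasFIIPartition_of_z1_z4_notMem_A_of_z4_notMem_F h (hFA h1) h4A h4
    · by_cases h4 : z4 ∈ F
      · by_cases h3B : z3 ∈ B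
        · exact c.hasFIIPartition_of_z1_z4_notMem_A_of_z3_z4_notMem_B h.symm (hFB h1) (hFB h4)
            (fun h3A => hAB h3A h3B) (hFA h4)
        · exact c.hasFIIPartition_of_z1_z4_notMem_A_of_z3_z4_notMem_B h (hFA h1) (hFA h4) h3B
            (hFB h4)
      · exact c.hasFIIPartition_of_z3_z4_notMem h h3 h4
  · by_cases h3 : z3 ∈ F
    · by_cases h4 : z4 ∈ F
      · by_cases h1A : z1 ∈ A
        · exact c.hasFIIPartition_of_z1_z4_notMem_A_of_z3_z4_notMem_B h.symm (hAB h1A) (hFB h4)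
            (hFA h3) (hFA h4)
        · exact c.hasFIIPartition_of_z1_z4_notMem_A_of_z3_z4_notMem_B h h1A (hFA h4) (hFB h3)
            (hFB h4)
      · exact c.symm.hasFIIPartition_of_z3_z4_notMem h h1 h4
    · exact c.hasFIIPartition_of_z1_z3_notMem h h1 h3

end IsFourCycleConfig

namespace SimpleGraph

variable {V : Type*} {G : SimpleGraph V} {v a b w : V} [Fintype (G.neighborSet v)]

theorem Adj.eq_or_eq_of_degree_le_two (ha : G.Adj v a) (hb : G.Adj v b) (hab : a ≠ b)
    (h : G.degree v ≤ 2) (hw : G.Adj v w) : w = a ∨ w = b := by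
  by_contra! hne
  have hsub : ({w, a, b} : Finset V) ⊆ G.neighborFinset v := by
    intro u hu
    simp only [Finset.mem_insert, Finset.mem_singleton] at hu
    rcases hu with rfl | rfl | rfl <;> simpa
  have := Finset.card_le_card hsub
  rw [Finset.card_eq_three.2 ⟨w, a, b, hne.1, hne.2, hab, rfl⟩, card_neighborFinset_eq_degree]
    at this
  omega

theorem Adj.eq_or_eq_or_eq_of_degree_le_three {d : V} (ha : G.Adj v a) (hb : G.Adj v b)
    (hd : G.Adj v d) (hab : a ≠ b) (had : a ≠ d) (hbd : b ≠ d)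
    (h : G.degree v ≤ 3) (hw : G.Adj v w) : w = a ∨ w = b ∨ w = d := by
  by_contra! hne
  have hsub : ({w, a, b, d} : Finset V) ⊆ G.neighborFinset v := by
    intro u hu
    simp only [Finset.mem_insert, Finset.mem_singleton] at hu
    rcases hu with rfl | rfl | rfl | rfl <;> simpa
  have := Finset.card_le_card hsub
  rw [card_neighborFinset_eq_degree, Finset.card_insert_of_notMem (by simp [hne]),
    Finset.card_eq_three.2 ⟨a, b, d, hab, had, hbd, rfl⟩] at this
  omega

end SimpleGraph

/-- Lemma 3.3 (ii): there is no such 4-cycle configuration in a minimal counterexample;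
as a reduction, if `G − S` has an FII-partition then so does `G`. -/
theorem hasFIIPartition_of_four_cycle_config {V : Type*} [Fintype V]
    (G : SimpleGraph V) (x1 x2 x3 x4 v1 v3 z1 z3 : V)
    (hne : List.Pairwise (· ≠ ·) [x1, x2, x3, x4, v1, v3])
    (e12 : G.Adj x1 x2) (e23 : G.Adj x2 x3) (e34 : G.Adj x3 x4) (e41 : G.Adj x4 x1)
    (hdx2 : G.degree x2 = 2)
    (hdx1 : G.degree x1 = 3) (hx1v1 : G.Adj x1 v1)
    (hdx3 : G.degree x3 = 3) (hx3v3 : G.Adj x3 v3)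
    (hdv1 : G.degree v1 = 2) (hv1z1 : G.Adj v1 z1)
    (hz1 : z1 ∉ ({x1, x2, x3, x4, v1, v3} : Set V))
    (hdv3 : G.degree v3 = 2) (hv3z3 : G.Adj v3 z3)
    (hz3 : z3 ∉ ({x1, x2, x3, x4, v1, v3} : Set V))
    (hdx4 : G.degree x4 ≤ 3)
    (h : HasFIIPartition (G.induce ({x1, x2, x3, x4, v1, v3} : Set V)ᶜ)) :
    HasFIIPartition G := by
  have hn : [x1, x2, x3, x4, v1, v3].Nodup := hne
  have hn' := hn
  simp only [List.nodup_cons, List.mem_cons, List.not_mem_nil] at hn'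
  simp only [Set.mem_insert_iff, Set.mem_singleton_iff, not_or] at hz1 hz3
  have a1 (w) := e12.eq_or_eq_or_eq_of_degree_le_three e41.symm hx1v1 (by grind) (by grind)
    (by grind) hdx1.le (w := w)
  have a2 (w) := e12.symm.eq_or_eq_of_degree_le_two e23 (by grind) hdx2.le (w := w)
  have a3 (w) := e23.symm.eq_or_eq_or_eq_of_degree_le_three e34 hx3v3 (by grind) (by grind)
    (by grind) hdx3.le (w := w)
  have b1 (w) := hx1v1.symm.eq_or_eq_of_degree_le_two hv1z1 (by grind) hdv1.le (w := w)
  have b3 (w) := hx3v3.symm.eq_or_eq_of_degree_le_two hv3z3 (by grind) hdv3.le (w := w)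
  have a4 : ∃ z4 ∈ ({x1, x2, x3, x4, v1, v3} : Set V)ᶜ,
      ∀ w, G.Adj x4 w → w = x1 ∨ w = x3 ∨ w = z4 := by
    by_cases hz : ∃ z4, G.Adj x4 z4 ∧ z4 ≠ x1 ∧ z4 ≠ x3
    · obtain ⟨z4, hz4, hz41, hz43⟩ := hz
      refine ⟨z4, ?_, fun w => e41.eq_or_eq_or_eq_of_degree_le_three e34.symm hz4 (by grind)
        hz41.symm hz43.symm hdx4⟩
      have := hz4.ne
      have := hz4.symm
      simp only [Set.mem_compl_iff, Set.mem_insert_iff, Set.mem_singleton_iff]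
      grind
    · push Not at hz
      exact ⟨z1, by simpa using hz1, fun w hw => by grind⟩
  obtain ⟨z4, hz4, a4⟩ := a4
  have c : IsFourCycleConfig G ({x1, x2, x3, x4, v1, v3} : Set V)ᶜ x1 x2 x3 x4 v1 v3 z1 z3 z4 :=
    ⟨hn, by simp, by simpa using hz1, by simpa using hz3, hz4, a1, a2, a3, a4, b1, b3⟩
  obtain ⟨F, A, B, h⟩ := h
  exact c.hasFIIPartition (h.isFIIPartitionOn c.eq_of_adj_of_mem)
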